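/- Let k and l be positive integers and N = 2^k·(2l+1). Every deterministic finite automaton over the one-letter alphabet that solves the promise problem A^N exactly (accepts a^(i·N) for every nonnegative even integer i and rejects a^(i·N) for every positive odd integer i) has at least 2^(k+1) states. -/

import Mathlib

theorem DFA.eval_replicate_add_congr {α σ : Type*} (M : DFA α σ) (x : α) {a b : ℕ}
    (h : M.eval (List.replicate a x) = M.eval (List.replicate b x)) (c : ℕ) :
    M.eval (List.replicate (a + c) x) = M.eval (List.replicate (b + c) x) := by
  simp only [DFA.eval] at h ⊢
  rw [List.replicate_add, List.replicate_add, DFA.evalFrom_of_append, DFA.evalFrom_of_append, h]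

theorem DFA.eval_replicate_add_mul {α σ : Type*} (M : DFA α σ) (x : α) {a p : ℕ}
    (h : M.eval (List.replicate (a + p) x) = M.eval (List.replicate a x))
    {n : ℕ} (hn : a ≤ n) (m : ℕ) :
    M.eval (List.replicate (n + m * p) x) = M.eval (List.replicate n x) := by
  induction m with
  | zero => simp
  | succ m ih =>
    rw [← ih]
    have := M.eval_replicate_add_congr x h (n - a + m * p)
    convert this using 3
    · rw [Nat.succ_mul]; omega
    · omega

/-- On a one-letter alphabet the states reached by words of length at most the number of states
repeat, so the run is eventually periodic with a small period. -/
theorem DFA.exists_eval_replicate_add_eq {α σ : Type*} [Fintype σ] (M : DFA α σ) (x : α) :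
    ∃ a p : ℕ, 0 < p ∧ p ≤ Fintype.card σ ∧
      M.eval (List.replicate (a + p) x) = M.eval (List.replicate a x) := by
  obtain ⟨i, j, hij, h⟩ := Fintype.exists_ne_map_eq_of_card_lt
    (fun i : Fin (Fintype.card σ + 1) => M.eval (List.replicate i x)) (by simp)
  wlog hlt : i < j generalizing i j
  · exact this j i hij.symm h.symm (lt_of_le_of_ne (not_lt.mp hlt) hij.symm)
  have hlt' : (i : ℕ) < j := hlt
  refine ⟨i, j - i, by omega, by omega, ?_⟩
  rw [Nat.add_sub_cancel' hlt'.le]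
  exact h.symm

/-- for `N = 2^k·(2l+1)`, any DFA over a one-letter alphabet solving
the promise problem `A^N` exactly has at least `2^(k+1)` states. -/
theorem dfa_solving_AN_lower_bound
    (k l : ℕ) (hk : 0 < k) (hl : 0 < l) (N : ℕ) (hN : N = 2 ^ k * (2 * l + 1))
    (σ : Type) [Fintype σ] (M : DFA Unit σ)
    (h_yes : ∀ i : ℕ, Even i → List.replicate (i * N) () ∈ M.accepts)
    (h_no : ∀ i : ℕ, Odd i → 0 < i → List.replicate (i * N) () ∉ M.accepts) :
    2 ^ (k + 1) ≤ Fintype.card σ := by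
  obtain ⟨a, p, hp, hpc, hper⟩ := M.exists_eval_replicate_add_eq ()
  obtain ⟨j, q, hq, hpq⟩ := Nat.exists_eq_two_pow_mul_odd hp.ne'
  refine le_trans ?_ hpc
  rcases Nat.lt_or_ge k j with hkj | hjk
  · calc 2 ^ (k + 1) ≤ 2 ^ j := Nat.pow_le_pow_right two_pos hkj
      _ ≤ p := by rw [hpq]; exact Nat.le_mul_of_pos_right _ hq.pos
  · exfalso
    have hN0 : 0 < N := by rw [hN]; positivity
    have ha : a ≤ 2 * a * N := by nlinarith
    have hqN : (2 * a + q) * N = 2 * a * N + 2 ^ (k - j) * (2 * l + 1) * p := by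
      obtain ⟨d, rfl⟩ := Nat.exists_eq_add_of_le hjk
      rw [hN, hpq, Nat.add_sub_cancel_left, pow_add]
      ring
    have hodd : Odd (2 * a + q) := (even_two_mul a).add_odd hq
    refine h_no _ hodd hodd.pos ?_
    rw [DFA.mem_accepts, hqN, M.eval_replicate_add_mul () hper ha]
    exact h_yes _ (even_two_mul a)
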